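/- If b ≥ 2, n is self-descriptive in base b, and the digit of n at position 1 equals 2 (the coefficient of b^(b−2), counting occurrences of the digit 1 in n), then the digit of n at position 2 (the coefficient of b^(b−3), counting occurrences of the digit 2 in n) equals 1. -/

import Mathlib

/-- `n` is self-descriptive in base `b`: its base-`b` digit list has length exactly `b`,
and for every `i < b`, the digit at position `i` counted from the most significant digit
(i.e. the coefficient of `b ^ (b - 1 - i)`) equals the number of occurrences of the
value `i` among the base-`b` digits of `n`. -/
def IsSelfDescriptive (b n : ℕ) : Prop :=
  (Nat.digits b n).length = b ∧
  ∀ i < b, n / b ^ (b - 1 - i) % b = (Nat.digits b n).count i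

theorem count_map_range_aux (g : ℕ → ℕ) (a m : ℕ) :
    ((List.range m).map g).count a = ∑ j ∈ Finset.range m, if g j = a then 1 else 0 := by
  induction m with
  | zero => simp
  | succ k ih =>
    rw [List.range_succ, List.map_append, List.count_append, ih, Finset.sum_range_succ]
    simp [List.count_singleton]

theorem digit_two_eq_one (b n : ℕ) (hb : 2 ≤ b) (h : IsSelfDescriptive b n)
    (h1 : n / b ^ (b - 2) % b = 2) : n / b ^ (b - 3) % b = 1 := by
  obtain ⟨hl, hc⟩ := h
  have hlt : ∀ j, n / b ^ j % b < b := fun j => Nat.mod_lt _ (by omega)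
  have hL : Nat.digits b n = (List.range b).map (fun j => n / b ^ j % b) := by
    apply List.ext_getElem
    · simp [hl]
    · intro i h₁ h₂
      have := Nat.getD_digits n i hb
      rw [List.getD_eq_getElem _ _ h₁] at this
      simp [this]
  have hb3 : 3 ≤ b := by have := hlt (b - 2); omega
  obtain ⟨f, hf⟩ : ∃ f : ℕ → ℕ, ∀ i, f i = n / b ^ (b - 1 - i) % b := ⟨_, fun _ => rfl⟩
  have hcount : ∀ i < b, f i = ∑ j ∈ Finset.range b, if f j = i then 1 else 0 := by
    intro i hi
    rw [hf, hc i hi, hL, count_map_range_aux, ← Finset.sum_range_reflect]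
    simp only [hf]
  have hfb : ∀ j, f j < b := fun j => by rw [hf]; exact hlt _
  have hsum : ∑ i ∈ Finset.range b, f i = b := by
    rw [Finset.sum_congr rfl (fun i hi => hcount i (Finset.mem_range.1 hi)), Finset.sum_comm]
    simp [hfb]
  have h1' : f 1 = 2 := by rw [hf, ← h1, Nat.sub_sub]
  have h2' : n / b ^ (b - 3) % b = f 2 := by rw [hf, Nat.sub_sub]
  rw [h2']
  have hge : 1 ≤ f 2 := by
    rw [hcount 2 (by omega)]
    have := Finset.single_le_sum (f := fun j => if f j = 2 then 1 else 0)
      (fun i _ => Nat.zero_le _) (Finset.mem_range.2 (show 1 < b by omega))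
    simpa [h1'] using this
  have h0 := hcount 0 (by omega)
  have hS : ∑ i ∈ Finset.range b, (f i + if f i = 0 then 1 else 0) = b + f 0 := by
    rw [Finset.sum_add_distrib, hsum, ← h0]
  obtain ⟨k, rfl⟩ := Nat.exists_eq_add_of_le' hb3
  rw [Finset.sum_range_succ', Finset.sum_range_succ', Finset.sum_range_succ'] at hS
  have hk : k ≤ ∑ i ∈ Finset.range k,
      (f (i + 1 + 1 + 1) + if f (i + 1 + 1 + 1) = 0 then 1 else 0) := by
    calc k = ∑ i ∈ Finset.range k, 1 := by simp
      _ ≤ _ := Finset.sum_le_sum (fun i _ => by split_ifs <;> omega)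
  simp only [zero_add, Nat.reduceAdd, h1'] at hS
  try simp only [Nat.reduceAdd, add_assoc] at hk hS
  omega
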